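/- arXiv:2203.06340 — 9 statements merged into one kernel-verified Lean document; each statement's English description precedes it below -/
import Mathlib

section
/- Let s be a prime power, let 1 ≤ u_1 ≤ u, and let n_A = (s−1)^{u_1−1} s^{u−u_1}. Then there exist D1, an orthogonal array OA(s^u, u_1, s, u_1), and D2, a Latin hypercube LHD(s^u, n_A), such that (D1, D2) is a marginally coupled design and D2 is a non-cascading Latin hypercube. -/
/-- `D` is an orthogonal array OA(n, m, s, t): in any `t` distinct columns,
every `t`-tuple of levels occurs in exactly `n / s^t` rows. -/
def IsOA (n m s t : ℕ) (D : Fin n → Fin m → Fin s) : Prop :=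
  ∀ cols : Fin t → Fin m, Function.Injective cols →
    ∀ lvl : Fin t → Fin s,
      {i : Fin n | ∀ r, D i (cols r) = lvl r}.ncard = n / s ^ t

/-- `D` is a Latin hypercube LHD(n, k): each column is a permutation of `{0, …, n-1}`. -/
def IsLHD (n k : ℕ) (D : Fin n → Fin k → Fin n) : Prop :=
  ∀ j, Function.Bijective fun i => D i j

/-- `(D1, D2)` is a marginally coupled design: for every column `c` of `D1`,
every level `ℓ`, and every column `j` of `D2`, the values `⌊D2 i j / s⌋` over
the rows `i` with `D1 i c = ℓ` are pairwise distinct. -/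
def IsMCD (n m k s : ℕ) (D1 : Fin n → Fin m → Fin s) (D2 : Fin n → Fin k → Fin n) : Prop :=
  ∀ (c : Fin m) (ℓ : Fin s) (j : Fin k) (i i' : Fin n),
    D1 i c = ℓ → D1 i' c = ℓ → (D2 i j : ℕ) / s = (D2 i' j : ℕ) / s → i = i'

/-- `D2` is non-cascading: no two distinct columns of the array with entries
`⌊D2 i j / s⌋` can be obtained from each other by a permutation of the levels
`{0, …, n/s - 1}`. -/
def NonCascading (n k s : ℕ) (D2 : Fin n → Fin k → Fin n) : Prop :=
  ∀ j j' : Fin k, j ≠ j' →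
    ¬ ∃ π : ℕ → ℕ, Set.BijOn π (Set.Iio (n / s)) (Set.Iio (n / s)) ∧
      ∀ i, (D2 i j : ℕ) / s = π ((D2 i j' : ℕ) / s)

section Construction

variable {F : Type*} [Field F] {m r : ℕ}

/-- The quotient of `F ^ (m + 1 + r)` by the line spanned by `(1, x)`, in coordinates. -/
def lineQuotient (x : (Fin m → {a : F // a ≠ 0}) × (Fin r → F))
    (v : (Fin (m + 1) → F) × (Fin r → F)) : (Fin m → F) × (Fin r → F) :=
  (fun k => v.1 k.succ - v.1 0 * x.1 k, fun k => v.2 k - v.1 0 * x.2 k)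

theorem eq_of_lineQuotient_eq_of_zero {x : (Fin m → {a : F // a ≠ 0}) × (Fin r → F)}
    {v w : (Fin (m + 1) → F) × (Fin r → F)} (h : lineQuotient x v = lineQuotient x w)
    (h0 : v.1 0 = w.1 0) : v = w := by
  have h1 := congrArg Prod.fst h
  have h2 := congrArg Prod.snd h
  simp only [lineQuotient, h0, funext_iff, sub_left_inj] at h1 h2
  refine Prod.ext (funext fun c => ?_) (funext h2)
  induction c using Fin.cases with
  | zero => exact h0
  | succ k => exact h1 k

theorem eq_of_lineQuotient_eq {x : (Fin m → {a : F // a ≠ 0}) × (Fin r → F)}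
    {v w : (Fin (m + 1) → F) × (Fin r → F)} (h : lineQuotient x v = lineQuotient x w)
    (c : Fin (m + 1)) (hc : v.1 c = w.1 c) : v = w := by
  refine eq_of_lineQuotient_eq_of_zero h ?_
  induction c using Fin.cases with
  | zero => exact hc
  | succ k =>
    have h1 := congrFun (congrArg Prod.fst h) k
    simp only [lineQuotient, hc, sub_right_inj] at h1
    exact mul_right_cancel₀ (x.1 k).2 h1

theorem eq_of_lineQuotient_factors {x y : (Fin m → {a : F // a ≠ 0}) × (Fin r → F)}
    (h : ∀ v w, lineQuotient y v = lineQuotient y w → lineQuotient x v = lineQuotient x w) :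
    x = y := by
  have key := h (Fin.cons 1 fun k => (y.1 k : F), y.2) (0, 0) (by
    simp [lineQuotient])
  have h1 := congrArg Prod.fst key
  have h2 := congrArg Prod.snd key
  simp only [lineQuotient, Fin.cons_succ, Fin.cons_zero, one_mul, Pi.zero_apply, zero_mul,
    sub_zero, funext_iff, sub_eq_zero] at h1 h2
  exact Prod.ext (funext fun k => Subtype.ext (h1 k).symm) (funext fun k => (h2 k).symm)

theorem exists_noncascading_mcd [Fintype F] (s : ℕ) (hs : Fintype.card F = s) :
    ∃ (D1 : Fin (s ^ (m + 1 + r)) → Fin (m + 1) → Fin s)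
      (D2 : Fin (s ^ (m + 1 + r)) → Fin ((s - 1) ^ m * s ^ r) → Fin (s ^ (m + 1 + r))),
      IsOA (s ^ (m + 1 + r)) (m + 1) s (m + 1) D1 ∧
      IsLHD (s ^ (m + 1 + r)) ((s - 1) ^ m * s ^ r) D2 ∧
      IsMCD (s ^ (m + 1 + r)) (m + 1) ((s - 1) ^ m * s ^ r) s D1 D2 ∧
      NonCascading (s ^ (m + 1 + r)) ((s - 1) ^ m * s ^ r) s D2 := by
  classical
  have hpos : 0 < s := hs ▸ Fintype.card_pos
  let eF : F ≃ Fin s := Fintype.equivFinOfCardEq hs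
  let eR : ((Fin (m + 1) → F) × (Fin r → F)) ≃ Fin (s ^ (m + 1 + r)) :=
    Fintype.equivFinOfCardEq (by simp [hs, pow_add])
  let eC : ((Fin m → {a : F // a ≠ 0}) × (Fin r → F)) ≃ Fin ((s - 1) ^ m * s ^ r) :=
    Fintype.equivFinOfCardEq (by simp [hs, Fintype.card_subtype_compl])
  let eT : ((Fin m → F) × (Fin r → F)) ≃ Fin (s ^ (m + r)) :=
    Fintype.equivFinOfCardEq (by simp [hs, pow_add])
  let e : Fin (s ^ (m + r)) × Fin s ≃ Fin (s ^ (m + 1 + r)) :=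
    finProdFinEquiv.trans (finCongr (by ring))
  have he (a b) : (e (a, b) : ℕ) / s = a := by
    simp [e, finProdFinEquiv, Nat.add_mul_div_left _ _ hpos, Nat.div_eq_of_lt b.2]
  let D1 : Fin (s ^ (m + 1 + r)) → Fin (m + 1) → Fin s := fun i c => eF ((eR.symm i).1 c)
  let D2 : Fin (s ^ (m + 1 + r)) → Fin ((s - 1) ^ m * s ^ r) → Fin (s ^ (m + 1 + r)) :=
    fun i j => e (eT (lineQuotient (eC.symm j) (eR.symm i)), eF ((eR.symm i).1 0))
  have hD2 (i j) : (D2 i j : ℕ) / s = eT (lineQuotient (eC.symm j) (eR.symm i)) := he _ _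
  refine ⟨D1, D2, fun cols hcols lvl => ?_, fun j => ?_, fun c l j i i' h h' hij => ?_,
    fun j j' hj => ?_⟩
  · let σ : Fin (m + 1) ≃ Fin (m + 1) :=
      Equiv.ofBijective cols (Finite.injective_iff_bijective.1 hcols)
    have hset : {i | ∀ k, D1 i (cols k) = lvl k} =
        eR '' ({fun c => eF.symm (lvl (σ.symm c))} ×ˢ Set.univ) := by
      ext i
      rw [Equiv.image_eq_preimage_symm]
      simp only [D1, Set.mem_ofPred_eq, Set.mem_preimage, Set.mem_prod, Set.mem_singleton_iff,
        Set.mem_univ, and_true, funext_iff]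
      refine σ.forall_congr fun k => ?_
      rw [Equiv.symm_apply_apply, Equiv.eq_symm_apply]
      rfl
    rw [hset, Set.ncard_image_of_injective _ eR.injective, Set.ncard_prod, Set.ncard_singleton,
      Set.ncard_univ, pow_add s (m + 1) r, Nat.mul_div_cancel_left _ (pow_pos hpos _)]
    simp [hs]
  · refine Finite.injective_iff_bijective.1 fun i i' h => ?_
    have h' := Prod.ext_iff.1 (e.injective h)
    exact eR.symm.injective
      (eq_of_lineQuotient_eq_of_zero (eT.injective h'.1) (eF.injective h'.2))
  · rw [hD2, hD2] at hij
    exact eR.symm.injective (eq_of_lineQuotient_eq (eT.injective (Fin.ext hij)) c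
      (eF.injective (h.trans h'.symm)))
  · rintro ⟨π, -, hπ⟩
    refine hj (eC.symm.injective (eq_of_lineQuotient_factors fun v w hvw => ?_))
    have hv := hπ (eR v)
    have hw := hπ (eR w)
    rw [hD2, hD2, Equiv.symm_apply_apply] at hv hw
    rw [hvw] at hv
    exact eT.injective (Fin.ext (hv.trans hw.symm))

end Construction

/-- for a prime power `s` and `1 ≤ u₁ ≤ u`, there is a marginally coupled
design `(D1, D2)` with `D1` an OA(s^u, u₁, s, u₁) and `D2` a non-cascading
LHD(s^u, (s-1)^(u₁-1) s^(u-u₁)). -/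
theorem stmt3 (s u u₁ : ℕ) (hs : IsPrimePow s) (hu₁ : 1 ≤ u₁) (hu : u₁ ≤ u) :
    ∃ (D1 : Fin (s ^ u) → Fin u₁ → Fin s)
      (D2 : Fin (s ^ u) → Fin ((s - 1) ^ (u₁ - 1) * s ^ (u - u₁)) → Fin (s ^ u)),
      IsOA (s ^ u) u₁ s u₁ D1 ∧
      IsLHD (s ^ u) ((s - 1) ^ (u₁ - 1) * s ^ (u - u₁)) D2 ∧
      IsMCD (s ^ u) u₁ ((s - 1) ^ (u₁ - 1) * s ^ (u - u₁)) s D1 D2 ∧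
      NonCascading (s ^ u) ((s - 1) ^ (u₁ - 1) * s ^ (u - u₁)) s D2 := by
  obtain ⟨m, rfl⟩ := Nat.exists_eq_add_of_le' hu₁
  obtain ⟨r, rfl⟩ := Nat.exists_eq_add_of_le hu
  obtain ⟨inst⟩ := Fintype.nonempty_field_iff.2 ((Fintype.card_fin s).symm ▸ hs)
  rw [Nat.add_sub_cancel, Nat.add_sub_cancel_left]
  exact @exists_noncascading_mcd (Fin s) inst m r _ s (Fintype.card_fin s)
end

section
/- Let s be a prime power, let 1 ≤ u_1 ≤ u, and let n_A = (s−1)^{u_1−1} s^{u−u_1}. Then there exist D1, an orthogonal array OA(s^u, n_A, s, 2), and D2, a Latin hypercube LHD(s^u, u_1), such that (D1, D2) is a marginally coupled design and D2 is a non-cascading Latin hypercube. -/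
/-- All fibers of a surjective homomorphism of finite groups have `|G| / |H|` elements. -/
theorem AddMonoidHom.ncard_fiber_mul_card {G H : Type*} [AddGroup G] [AddGroup H] [Finite G]
    (f : G →+ H) (hf : Function.Surjective f) (y : H) :
    {x : G | f x = y}.ncard * Nat.card H = Nat.card G := by
  obtain ⟨x₀, rfl⟩ := hf y
  have hfib : {x : G | f x = f x₀}.ncard = Nat.card f.ker := by
    rw [← Nat.card_coe_set_eq]
    refine Nat.card_congr
      ⟨fun x => ⟨x.1 - x₀, ?_⟩, fun x => ⟨x.1 + x₀, ?_⟩, fun x => ?_, fun x => ?_⟩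
    · rw [AddMonoidHom.mem_ker, map_sub, x.2, sub_self]
    · have hx : f x.1 = 0 := x.2
      simp [hx]
    · simp
    · simp
  have hquot : Nat.card (G ⧸ f.ker) = Nat.card H :=
    Nat.card_congr (QuotientAddGroup.quotientKerEquivOfSurjective f hf).toEquiv
  rw [hfib, ← hquot, mul_comm, ← AddSubgroup.card_eq_card_quotient_mul_card_addSubgroup]

/-- Two dot products with vectors that agree and equal `1` at `o` but differ somewhere
are jointly surjective. -/
theorem exists_dotProduct_eq_of_ne {ι F : Type*} [Fintype ι] [Field F] {o : ι} {v w : ι → F}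
    (hv : v o = 1) (hw : w o = 1) (hvw : v ≠ w) (a b : F) :
    ∃ x : ι → F, v ⬝ᵥ x = a ∧ w ⬝ᵥ x = b := by
  classical
  obtain ⟨p, hp⟩ := Function.ne_iff.mp hvw
  have hd : v p - w p ≠ 0 := sub_ne_zero.mpr hp
  refine ⟨Pi.single o (a - v p * ((a - b) / (v p - w p))) +
    Pi.single p ((a - b) / (v p - w p)), ?_, ?_⟩
  · simp [dotProduct_add, dotProduct_single, hv]
  · simp only [dotProduct_add, dotProduct_single, hw]
    field_simp
    ring

/-- The points of `F ^ ι` can be numbered so that the blocks of `|F|` consecutive numbers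
are the lines in direction `j`. -/
theorem exists_equiv_fin_div_eq_iff {ι F : Type*} [Fintype ι] [Finite F] {s N : ℕ}
    (hs : Nat.card F = s) (hN : s ^ Fintype.card ι = N) (j : ι) :
    ∃ E : (ι → F) ≃ Fin N, ∀ x y, (E x : ℕ) / s = (E y : ℕ) / s ↔ ∀ i, i ≠ j → x i = y i := by
  classical
  have hM : Nat.card ({i // i ≠ j} → F) * s = N := by
    rw [← hN, ← hs, mul_comm, ← Nat.card_prod, ← Nat.card_congr (Equiv.funSplitAt j F),
      Nat.card_fun, Nat.card_eq_fintype_card (α := ι)]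
  let e := Finite.equivFin ({i // i ≠ j} → F)
  refine ⟨(((Equiv.funSplitAt j F).trans (Equiv.prodComm _ _)).trans
    (e.prodCongr (Finite.equivFinOfCardEq hs))).trans
    (finProdFinEquiv.trans (finCongr hM)), fun x y => ?_⟩
  have hval : ∀ (a : Fin (Nat.card ({i // i ≠ j} → F))) (b : Fin s),
      ((b : ℕ) + s * a) / s = a := fun a b => by
    rw [Nat.add_mul_div_left _ _ b.pos, Nat.div_eq_of_lt b.isLt, zero_add]
  simp [finProdFinEquiv, hval, Fin.val_inj, funext_iff]

theorem exists_mcd_nonCascading {F : Type*} [Field F] [Finite F] {s : ℕ} (hs : Nat.card F = s)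
    (k m : ℕ) :
    ∃ (D1 : Fin (s ^ (k + 1 + m)) → Fin ((s - 1) ^ k * s ^ m) → Fin s)
      (D2 : Fin (s ^ (k + 1 + m)) → Fin (k + 1) → Fin (s ^ (k + 1 + m))),
      IsOA (s ^ (k + 1 + m)) ((s - 1) ^ k * s ^ m) s 2 D1 ∧
      IsLHD (s ^ (k + 1 + m)) (k + 1) D2 ∧
      IsMCD (s ^ (k + 1 + m)) ((s - 1) ^ k * s ^ m) (k + 1) s D1 D2 ∧
      NonCascading (s ^ (k + 1 + m)) (k + 1) s D2 := by
  classical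
  have hspos : 0 < s := hs ▸ Nat.card_pos
  let ι := Fin (k + 1) ⊕ Fin m
  have hN : s ^ Fintype.card ι = s ^ (k + 1 + m) := by simp [ι]
  have hrows : Nat.card (ι → F) = s ^ (k + 1 + m) := by
    rw [Nat.card_fun, hs, Nat.card_eq_fintype_card, hN]
  have hcols : Nat.card ((Fin k → Fˣ) × (Fin m → F)) = (s - 1) ^ k * s ^ m := by
    simp [Nat.card_prod, Nat.card_fun, Nat.card_units, hs]
  let e : Fin (s ^ (k + 1 + m)) ≃ (ι → F) := (Finite.equivFinOfCardEq hrows).symm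
  let c := (Finite.equivFinOfCardEq hcols).symm
  let l : F ≃ Fin s := Finite.equivFinOfCardEq hs
  let z : (Fin k → Fˣ) × (Fin m → F) → ι → F := fun q =>
    Sum.elim (Fin.cons 1 fun i => (q.1 i : F)) q.2
  have hz_inj : Function.Injective z := fun q q' h => by
    refine Prod.ext (funext fun i => Units.ext ?_) (funext fun i => ?_)
    · simpa [z] using congrFun h (Sum.inl i.succ)
    · simpa [z] using congrFun h (Sum.inr i)
  have hz_zero : ∀ q, z q (Sum.inl 0) = 1 := fun q => by simp [z]
  have hz_ne : ∀ q j, z q (Sum.inl j) ≠ 0 := fun q j => by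
    refine Fin.cases ?_ (fun i => ?_) j <;> simp [z]
  choose E hE using fun j : Fin (k + 1) =>
    exists_equiv_fin_div_eq_iff (F := F) hs hN (Sum.inl j : ι)
  refine ⟨fun i q => l (z (c q) ⬝ᵥ e i), fun i j => E j (e i), ?_, ?_, ?_, ?_⟩
  · intro cols hcol lvl
    let f : (ι → F) →+ (Fin 2 → F) :=
      { toFun := fun x r => z (c (cols r)) ⬝ᵥ x
        map_zero' := by ext; simp
        map_add' := fun x y => by ext; simp [dotProduct_add] }
    have hf : Function.Surjective f := fun y => by
      have hne : z (c (cols 0)) ≠ z (c (cols 1)) := fun h =>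
        absurd (hcol (c.injective (hz_inj h))) (by decide)
      obtain ⟨x, h0, h1⟩ :=
        exists_dotProduct_eq_of_ne (hz_zero _) (hz_zero _) hne (y 0) (y 1)
      exact ⟨x, funext (Fin.forall_fin_two.mpr ⟨h0, h1⟩)⟩
    have key := f.ncard_fiber_mul_card hf fun r => l.symm (lvl r)
    have himg : {x | f x = fun r => l.symm (lvl r)} =
        e '' {i | ∀ r, l (z (c (cols r)) ⬝ᵥ e i) = lvl r} := by
      rw [Equiv.image_eq_preimage_symm]
      ext x
      simp [funext_iff, f, Equiv.eq_symm_apply]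
    rw [himg, Set.ncard_image_of_injective _ e.injective, hrows, Nat.card_fun, hs,
      Nat.card_fin] at key
    exact (Nat.div_eq_of_eq_mul_left (pow_pos hspos 2) key.symm).symm
  · exact fun j => (e.trans (E j)).bijective
  · intro q ℓ j i i' h h' hdiv
    have hoff := (hE j _ _).mp hdiv
    have hdot : z (c q) ⬝ᵥ (e i - e i') = 0 := by
      rw [dotProduct_sub, sub_eq_zero]
      exact l.injective (h.trans h'.symm)
    have hsum : z (c q) ⬝ᵥ (e i - e i') =
        z (c q) (Sum.inl j) * (e i (Sum.inl j) - e i' (Sum.inl j)) :=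
      Finset.sum_eq_single _ (fun b _ hb => by simp [hoff b hb]) (by simp)
    rw [hsum] at hdot
    have hj := sub_eq_zero.mp ((mul_eq_zero.mp hdot).resolve_left (hz_ne _ j))
    refine e.injective (funext fun b => ?_)
    by_cases hb : b = Sum.inl j
    · rw [hb, hj]
    · exact hoff b hb
  · rintro j j' hjj' ⟨π, -, hπ⟩
    have hsame := (hE j' 0 (Pi.single (Sum.inl j') 1)).mpr fun b hb => by simp [hb]
    have h0 := hπ (e.symm 0)
    have h1 := hπ (e.symm (Pi.single (Sum.inl j') 1))
    simp only [Equiv.apply_symm_apply] at h0 h1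
    have := (hE j _ _).mp (h0.trans ((congrArg π hsame).trans h1.symm)) (Sum.inl j')
      (fun h => hjj' (Sum.inl_injective h).symm)
    simp at this

/-- for a prime power `s` and `1 ≤ u₁ ≤ u`, there is a marginally coupled
design `(D1, D2)` with `D1` an OA(s^u, (s-1)^(u₁-1) s^(u-u₁), s, 2) and `D2` a
non-cascading LHD(s^u, u₁). -/
theorem stmt4 (s u u₁ : ℕ) (hs : IsPrimePow s) (hu₁ : 1 ≤ u₁) (hu : u₁ ≤ u) :
    ∃ (D1 : Fin (s ^ u) → Fin ((s - 1) ^ (u₁ - 1) * s ^ (u - u₁)) → Fin s)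
      (D2 : Fin (s ^ u) → Fin u₁ → Fin (s ^ u)),
      IsOA (s ^ u) ((s - 1) ^ (u₁ - 1) * s ^ (u - u₁)) s 2 D1 ∧
      IsLHD (s ^ u) u₁ D2 ∧
      IsMCD (s ^ u) ((s - 1) ^ (u₁ - 1) * s ^ (u - u₁)) u₁ s D1 D2 ∧
      NonCascading (s ^ u) u₁ s D2 := by
  obtain ⟨k, rfl⟩ := Nat.exists_eq_add_of_le' hu₁
  obtain ⟨m, rfl⟩ := Nat.exists_eq_add_of_le hu
  obtain ⟨hF⟩ := Fintype.nonempty_field_iff (α := Fin s).mpr (by simpa using hs)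
  rw [Nat.add_sub_cancel, Nat.add_sub_cancel_left]
  exact exists_mcd_nonCascading (F := Fin s) (Nat.card_fin s) k m
end

section
/- Let F be a finite field with s elements, s > 2, let 2 ≤ u_1 ≤ u, and let z = Σ_{i=1}^{u_1} λ_i e_i with λ_i ∈ F and at least two of the coefficients λ_1, …, λ_{u_1} nonzero. Then there exists a vector x ∈ 𝒜 such that ⟨z, x⟩ = 0, i.e., z ∈ O(x). -/
/-- A linear form over a finite field with more than two elements and with at least two nonzero
coefficients has a zero all of whose coordinates are nonzero. -/
theorem exists_forall_ne_zero_sum_mul_eq_zero {F ι : Type*} [Field F] [Fintype F] [Fintype ι]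
    (hs : 2 < Fintype.card F) (z : ι → F) {i j : ι} (hij : i ≠ j) (hi : z i ≠ 0) (hj : z j ≠ 0) :
    ∃ x : ι → F, (∀ k, x k ≠ 0) ∧ ∑ k, z k * x k = 0 := by
  classical
  set c : F := ∑ k ∈ (Finset.univ.erase j).erase i, z k with hc
  obtain ⟨a, ha⟩ : ∃ a : F, a ∉ ({0, -c / z i} : Finset F) := by
    by_contra! h
    have hcard := Finset.card_le_card (fun a _ => h a : Finset.univ ⊆ ({0, -c / z i} : Finset F))
    rw [Finset.card_univ] at hcard
    have := Finset.card_le_two (a := (0 : F)) (b := -c / z i)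
    omega
  simp only [Finset.mem_insert, Finset.mem_singleton, not_or] at ha
  obtain ⟨ha0, hac⟩ := ha
  have hne : c + z i * a ≠ 0 := fun h => hac (by
    rw [eq_div_iff hi]
    linear_combination h)
  refine ⟨fun k => if k = j then -(c + z i * a) / z j else if k = i then a else 1, ?_, ?_⟩
  · intro k
    dsimp only
    split_ifs
    · exact div_ne_zero (neg_ne_zero.mpr hne) hj
    · exact ha0
    · exact one_ne_zero
  · have hmem : i ∈ Finset.univ.erase j := by simp [hij]
    rw [← Finset.add_sum_erase _ _ (Finset.mem_univ j), ← Finset.add_sum_erase _ _ hmem]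
    have hrest : ∑ k ∈ (Finset.univ.erase j).erase i,
        z k * (if k = j then -(c + z i * a) / z j else if k = i then a else 1) = c := by
      refine Finset.sum_congr rfl fun k hk => ?_
      simp only [Finset.mem_erase] at hk
      simp [hk.1, hk.2.1]
    rw [hrest]
    simp only [if_true, if_neg hij]
    field_simp
    ring

/-- for a finite field `F` with `|F| = s > 2`, `2 ≤ u₁ ≤ u`, and
`z = Σ_{i=1}^{u₁} λᵢ eᵢ` with at least two nonzero coefficients (formalized as:
`z` vanishes on the coordinates with 0-based index `≥ u₁` and has at least two
nonzero entries), there exists `x ∈ 𝒜` (i.e. `x` has first entry `1` and nonzero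
entries in the 0-based positions `1, …, u₁ - 1`) with `⟨z, x⟩ = 0`. -/
theorem stmt5 {F : Type*} [Field F] [Fintype F] (hs : 2 < Fintype.card F)
    (u u₁ : ℕ) (hu₁ : 2 ≤ u₁) (hu : u₁ ≤ u)
    (z : Fin u → F) (hsupp : ∀ i : Fin u, u₁ ≤ (i : ℕ) → z i = 0)
    (htwo : ∃ i j : Fin u, i ≠ j ∧ z i ≠ 0 ∧ z j ≠ 0) :
    ∃ x : Fin u → F,
      (x ⟨0, by omega⟩ = 1 ∧ ∀ i : Fin u, 1 ≤ (i : ℕ) → (i : ℕ) < u₁ → x i ≠ 0) ∧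
      ∑ i, z i * x i = 0 := by
  obtain ⟨i, j, hij, hi, hj⟩ := htwo
  obtain ⟨x, hx, hsum⟩ := exists_forall_ne_zero_sum_mul_eq_zero hs z hij hi hj
  refine ⟨fun k => x k * (x ⟨0, by omega⟩)⁻¹, ⟨mul_inv_cancel₀ (hx _), fun k _ _ =>
    mul_ne_zero (hx k) (inv_ne_zero (hx _))⟩, ?_⟩
  simp only [← mul_assoc, ← Finset.sum_mul, hsum, zero_mul]
end

section
/- Suppose {b_{i_1}, …, b_{i_{n*}}} ⊆ {b_1, …, b_{n_B}} is a subset such that any min(n*, u_1) of its elements are linearly independent over F. Then for every v with 1 ≤ v ≤ n* and any choice of v distinct indices i_1 < … < i_v from this subset, the set ∩_{j=1}^{v} Ē_{i_j} contains exactly f(v) elements, where f(v) = (s−1)^v s^{u_1−v} for 1 ≤ v ≤ u_1, and f(v) = m* for u_1 + 1 ≤ v ≤ n* with m* = s^{u_1}[1 − C(v,1)s^{−1} + C(v,2)s^{−2} − … + (−1)^{u_1} C(v,u_1)s^{−u_1}] + Σ_{i=u_1+1}^{v} (−1)^i C(v, i). -/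
/-- The count `f(v)` of the paper: `f(v) = (s-1)^v s^(u₁-v)` for `1 ≤ v ≤ u₁`, and
`f(v) = s^{u₁}[1 - C(v,1)s⁻¹ + ⋯ + (-1)^{u₁} C(v,u₁)s^{-u₁}] + Σ_{i=u₁+1}^v (-1)^i C(v,i)`
for `v > u₁` (written with integer arithmetic). -/
def fCount (s u₁ v : ℕ) : ℤ :=
  if v ≤ u₁ then ((s : ℤ) - 1) ^ v * (s : ℤ) ^ (u₁ - v)
  else (∑ i ∈ Finset.range (u₁ + 1), (-1) ^ i * (v.choose i : ℤ) * (s : ℤ) ^ (u₁ - i))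
    + ∑ i ∈ Finset.Icc (u₁ + 1) v, (-1) ^ i * (v.choose i : ℤ)

/-- Linearly independent linear equations, indexed by `T`, on `F^n` have `|F|^(n - #T)` common
solutions. -/
theorem card_solutions_of_linearIndependent {F κ : Type*} [Field F] [Fintype F] [DecidableEq F]
    {n : ℕ} (c : κ → Fin n → F) (T : Finset κ) (hT : LinearIndependent F (fun t : T => c t)) :
    (Finset.univ.filter fun z : Fin n → F => ∀ t ∈ T, z ⬝ᵥ c t = 0).card
      = Fintype.card F ^ (n - T.card) := by
  classical
  set M : Matrix T (Fin n) F := Matrix.of fun t => c t with hM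
  have hrank : M.rank = T.card := by
    have h := LinearIndependent.rank_matrix (M := M) hT
    simpa using h
  have hdim := LinearMap.finrank_range_add_finrank_ker M.mulVecLin
  rw [show Module.finrank F (LinearMap.range M.mulVecLin) = T.card from hrank,
    Module.finrank_fin_fun] at hdim
  have hker := Module.card_eq_pow_finrank (K := F) (V := LinearMap.ker M.mulVecLin)
  rw [show n - T.card = Module.finrank F (LinearMap.ker M.mulVecLin) by omega, ← hker, ← Fintype.card_subtype]
  refine Fintype.card_congr (Equiv.subtypeEquivRight fun z => ?_)
  rw [LinearMap.mem_ker, Matrix.mulVecLin_apply, funext_iff, Subtype.forall]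
  simp only [Matrix.mulVec, hM, Matrix.of_apply, dotProduct_comm z, Pi.zero_apply]

/-- For vectors of `F^n` in general position, the equations indexed by `T` have
`|F|^(n - #T)` common solutions, also when `n < #T` (truncated subtraction). -/
theorem card_solutions_of_generalPosition {F κ : Type*} [Field F] [Fintype F] [DecidableEq F]
    {n : ℕ} (c : κ → Fin n → F)
    (hc : ∀ T : Finset κ, T.card ≤ n → LinearIndependent F (fun t : T => c t))
    (T : Finset κ) :
    (Finset.univ.filter fun z : Fin n → F => ∀ t ∈ T, z ⬝ᵥ c t = 0).card
      = Fintype.card F ^ (n - T.card) := by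
  rcases le_total T.card n with h | h
  · exact card_solutions_of_linearIndependent c T (hc T h)
  obtain ⟨T', hT', hcard⟩ := Finset.exists_subset_card_eq h
  have h1 := card_solutions_of_linearIndependent c T' (hc T' hcard.le)
  rw [hcard, Nat.sub_self, pow_zero] at h1
  rw [Nat.sub_eq_zero_of_le h, pow_zero]
  refine le_antisymm (h1 ▸ Finset.card_le_card fun z hz => ?_) (Finset.card_pos.2 ⟨0, by simp⟩)
  simp only [Finset.mem_filter, Finset.mem_univ, true_and] at hz ⊢
  exact fun t ht => hz t (hT' ht)

theorem fCount_eq_sum (s n v : ℕ) :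
    fCount s n v
      = ∑ i ∈ Finset.range (v + 1), (v.choose i : ℤ) * ((-1) ^ i * (s : ℤ) ^ (n - i)) := by
  unfold fCount
  split_ifs with h
  · rw [sub_eq_neg_add, add_pow, Finset.sum_mul]
    refine Finset.sum_congr rfl fun i hi => ?_
    have hi : i ≤ v := Nat.lt_succ_iff.1 (Finset.mem_range.1 hi)
    rw [show n - i = (v - i) + (n - v) by omega, pow_add]
    ring
  · rw [← Finset.sum_range_add_sum_Ico _ (show n + 1 ≤ v + 1 by omega)]
    congr 1
    · exact Finset.sum_congr rfl fun i _ => by ring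
    · refine Finset.sum_congr (by ext; simp) fun i hi => ?_
      rw [Nat.sub_eq_zero_of_le (by have := (Finset.mem_Ico.1 hi).1; omega)]
      ring

/-- The number of vectors orthogonal to none of the vectors indexed by `S`, for vectors of `F^n`
in general position. -/
theorem card_nonorthogonal_of_generalPosition {F κ : Type*} [Field F] [Fintype F] [DecidableEq F]
    {n : ℕ} (c : κ → Fin n → F)
    (hc : ∀ T : Finset κ, T.card ≤ n → LinearIndependent F (fun t : T => c t))
    (S : Finset κ) :
    ((Finset.univ.filter fun z : Fin n → F => ∀ t ∈ S, z ⬝ᵥ c t ≠ 0).card : ℤ)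
      = fCount (Fintype.card F) n S.card := by
  classical
  let A : κ → Finset (Fin n → F) := fun t => Finset.univ.filter fun z => z ⬝ᵥ c t = 0
  have hcompl : (Finset.univ.filter fun z : Fin n → F => ∀ t ∈ S, z ⬝ᵥ c t ≠ 0)
      = S.inf fun t => (A t)ᶜ := by
    ext z
    simp [A, Finset.mem_inf]
  have hinf (T : Finset κ) : ((T.inf A).card : ℤ) = (Fintype.card F : ℤ) ^ (n - T.card) := by
    rw [← Nat.cast_pow, ← card_solutions_of_generalPosition c hc T]
    congr 2
    ext z
    simp [A, Finset.mem_inf]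
  rw [hcompl, Finset.inclusion_exclusion_card_inf_compl, fCount_eq_sum]
  simp only [hinf]
  rw [Finset.sum_powerset_apply_card fun i => (-1 : ℤ) ^ i * (Fintype.card F : ℤ) ^ (n - i)]
  simp only [nsmul_eq_mul]

/-- Independence of all subfamilies of size `min N n` gives independence of all those of size at
most `n`. -/
theorem linearIndependent_of_card_eq_min {F V : Type*} [Field F] [AddCommGroup V] [Module F V]
    {N n : ℕ} (w : Fin N → V)
    (hw : ∀ T : Finset (Fin N), T.card = min N n → LinearIndependent F (fun t : T => w t))
    (T : Finset (Fin N)) (hT : T.card ≤ n) : LinearIndependent F (fun t : T => w t) := by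
  obtain ⟨T', hTT', hcard⟩ := Finset.exists_superset_card_eq (s := T) (n := min N n)
    (le_min (by simpa using T.card_le_univ) hT) (by simp)
  exact (hw T' hcard).comp (fun t : T => (⟨t, hTT' t.2⟩ : T'))
    fun a b h => Subtype.ext (congrArg (fun t : T' => (t : Fin N)) h)

theorem extend_castLE_restrict {F : Type*} [Zero F] {n u : ℕ} (hn : n ≤ u) (x : Fin u → F)
    (hx : ∀ i : Fin u, n ≤ (i : ℕ) → x i = 0) :
    Function.extend (Fin.castLE hn) (x ∘ Fin.castLE hn) 0 = x := by
  ext i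
  by_cases h : (i : ℕ) < n
  · exact (Fin.castLE_injective hn).extend_apply (x ∘ Fin.castLE hn) 0 ⟨i, h⟩
  · rw [Function.extend_apply' _ _ _ (by rintro ⟨j, rfl⟩; exact h j.2), hx i (not_lt.1 h)]
    rfl

theorem sum_mul_eq_restrict_dotProduct {F : Type*} [Semiring F] {n u : ℕ} (hn : n ≤ u)
    (z x : Fin u → F) (hz : ∀ i : Fin u, n ≤ (i : ℕ) → z i = 0) :
    ∑ i, z i * x i = (z ∘ Fin.castLE hn) ⬝ᵥ (x ∘ Fin.castLE hn) := by
  refine (Finset.sum_of_injOn (Fin.castLE hn) (Fin.castLE_injective hn).injOn (by simp) ?_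
    fun i _ => rfl).symm
  intro i _ hi
  have hni : n ≤ (i : ℕ) := not_lt.1 fun h => hi ⟨⟨i, h⟩, by simp, rfl⟩
  rw [hz i hni, zero_mul]


/-- if `{b_{i₁}, …, b_{i_{n*}}}` is a subset of the `b`-vectors such that any
`min(n*, u₁)` of its elements are linearly independent, then for every `1 ≤ v ≤ n*` and any
choice `S` of `v` distinct indices from this subset, `∩_{j∈S} Ē_j` has exactly `f(v)`
elements. -/
theorem stmt7 {F : Type*} [Field F] [Fintype F]
    (u u₁ nstar : ℕ) (hu₁ : 1 ≤ u₁) (hu : u₁ ≤ u)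
    (b : Fin ((Fintype.card F - 1) ^ (u₁ - 1)) → Fin u → F)
    (hb_inj : Function.Injective b)
    (hb_enum : ∀ x : Fin u → F,
      (x ⟨0, by omega⟩ = 1 ∧ (∀ i : Fin u, 1 ≤ (i : ℕ) → (i : ℕ) < u₁ → x i ≠ 0) ∧
        (∀ i : Fin u, u₁ ≤ (i : ℕ) → x i = 0)) ↔ ∃ t, b t = x)
    (ι : Fin nstar → Fin ((Fintype.card F - 1) ^ (u₁ - 1)))
    (hι : Function.Injective ι)
    (hindep : ∀ T : Finset (Fin nstar), T.card = min nstar u₁ →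
      LinearIndependent F (fun t : T => b (ι t.1)))
    (v : ℕ) (hv1 : 1 ≤ v) (hv2 : v ≤ nstar)
    (S : Finset (Fin nstar)) (hS : S.card = v) :
    ({z : Fin u → F | (∀ i : Fin u, u₁ ≤ (i : ℕ) → z i = 0) ∧
        ∀ t ∈ S, ∑ i, z i * b (ι t) i ≠ 0}.ncard : ℤ)
      = fCount (Fintype.card F) u₁ v := by
  classical
  have hb_zero (t) (i : Fin u) (hi : u₁ ≤ (i : ℕ)) : b t i = 0 :=
    ((hb_enum (b t)).2 ⟨t, rfl⟩).2.2 i hi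
  let c : Fin nstar → Fin u₁ → F := fun t => b (ι t) ∘ Fin.castLE hu
  have hc (T : Finset (Fin nstar)) (hT : T.card ≤ u₁) :
      LinearIndependent F (fun t : T => c t) := by
    refine LinearIndependent.of_comp (Function.ExtendByZero.linearMap F (Fin.castLE hu)) ?_
    have hext : (Function.ExtendByZero.linearMap F (Fin.castLE hu)) ∘ (fun t : T => c t)
        = fun t : T => b (ι t) := funext fun t => extend_castLE_restrict hu _ (hb_zero _)
    exact hext ▸ linearIndependent_of_card_eq_min (fun t => b (ι t)) hindep T hT
  rw [← hS, ← card_nonorthogonal_of_generalPosition c hc S, ← Set.ncard_coe_finset]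
  congr 1
  refine Set.ncard_congr (fun z _ => z ∘ Fin.castLE hu) ?_ ?_ ?_
  · rintro z ⟨hz, hzS⟩
    simp only [Finset.coe_filter, Finset.mem_univ, true_and, Set.mem_ofPred_eq]
    exact fun t ht => sum_mul_eq_restrict_dotProduct hu z (b (ι t)) hz ▸ hzS t ht
  · intro z z' hz hz' h
    rw [← extend_castLE_restrict hu z hz.1, ← extend_castLE_restrict hu z' hz'.1]
    exact congrArg (fun y => Function.extend (Fin.castLE hu) y 0) h
  · intro y hy
    simp only [Finset.coe_filter, Finset.mem_univ, true_and, Set.mem_ofPred_eq] at hy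
    have hres : Function.extend (Fin.castLE hu) y 0 ∘ Fin.castLE hu = y :=
      Function.extend_comp (Fin.castLE_injective hu) y 0
    have hzero (i : Fin u) (hi : u₁ ≤ (i : ℕ)) :
        Function.extend (Fin.castLE hu) y 0 i = 0 :=
      Function.extend_apply' _ _ _ (by rintro ⟨j, rfl⟩; exact (not_lt.2 hi) j.2)
    refine ⟨Function.extend (Fin.castLE hu) y 0, ⟨hzero, fun t ht => ?_⟩, hres⟩
    rw [sum_mul_eq_restrict_dotProduct hu _ _ hzero, hres]
    exact hy t ht
end

section
/- Let F be a finite field with s elements, s > 2, and let u_1 ≥ 3. Suppose b_1, …, b_n ∈ F^{u_1} (with n ≥ u_1) are vectors such that any u_1 of them are linearly independent. Then n ≤ u_1 + 1 if s ≤ u_1; n ≤ s + u_1 − 2 if s > u_1 and s is odd; and n ≤ s + u_1 − 1 in all other cases. -/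
open Module Finset

/-- The family `b` restricted to `A` is an arc of strength `m`: any `m` of its members are
linearly independent. -/
def IsLinearArc (F : Type*) {V ι : Type*} [Field F] [AddCommGroup V] [Module F V]
    (b : ι → V) (A : Finset ι) (m : ℕ) : Prop :=
  ∀ T ⊆ A, T.card = m → LinearIndepOn F b (T : Set ι)

namespace IsLinearArc

variable {F V ι : Type*} [Field F] [AddCommGroup V] [Module F V] {b : ι → V} {A : Finset ι}
  {m : ℕ}

lemma mono {B : Finset ι} (h : IsLinearArc F b A m) (hBA : B ⊆ A) : IsLinearArc F b B m :=
  fun T hT ↦ h T (hT.trans hBA)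

lemma linearIndepOn (h : IsLinearArc F b A m) (hm : m ≤ A.card) {T : Finset ι} (hT : T ⊆ A)
    (hTm : T.card ≤ m) : LinearIndepOn F b (T : Set ι) := by
  obtain ⟨U, hTU, hUA, hU⟩ := exists_subsuperset_card_eq hT hTm hm
  exact (h U hUA hU).mono (by exact_mod_cast hTU)

lemma ne_zero (h : IsLinearArc F b A m) (hm : m ≤ A.card) (hm1 : 1 ≤ m) {i : ι} (hi : i ∈ A) :
    b i ≠ 0 :=
  (h.linearIndepOn hm (T := {i}) (by simpa) (by simpa)).ne_zero (i := i) (by simp)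

lemma eq_of_eq_smul (h : IsLinearArc F b A m) (hm : m ≤ A.card) (hm2 : 2 ≤ m) {i j : ι}
    (hi : i ∈ A) (hj : j ∈ A) {c : F} (hc : b i = c • b j) : i = j := by
  classical
  by_contra hij
  have hl := h.linearIndepOn hm (T := {i, j}) (by simp [insert_subset_iff, hi, hj])
    (card_le_two.trans hm2)
  rw [coe_pair, LinearIndepOn.pair_iff b hij] at hl
  simpa using (hl 1 (-c) (by simp [hc])).1

/-- Projecting from `S` lowers the strength of an arc by the size of `S`. -/
lemma mkQ [DecidableEq ι] {S : Finset ι} (h : IsLinearArc F b A (m + S.card)) (hS : S ⊆ A) :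
    IsLinearArc F ((Submodule.span F (b '' S)).mkQ ∘ b) (A \ S) m := by
  intro T hT hTm
  have hd : Disjoint S T := (subset_sdiff.1 hT).2.symm
  have hu := h (S ∪ T) (union_subset hS (hT.trans sdiff_subset))
    (by rw [card_union_of_disjoint hd, hTm, add_comm])
  rw [coe_union, linearIndepOn_union_iff_quotient (by exact_mod_cast hd)] at hu
  exact hu.2

lemma finrank_quotient [FiniteDimensional F V] {S : Finset ι}
    (h : IsLinearArc F b A (m + S.card)) (hA : m + S.card ≤ A.card) (hS : S ⊆ A)
    (hV : finrank F V = m + S.card) :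
    finrank F (V ⧸ Submodule.span F (b '' S)) = m := by
  have hl := h.linearIndepOn hA hS (by simp)
  have h1 := finrank_span_eq_card hl
  have h2 := (Submodule.span F (b '' S)).finrank_quotient_add_finrank
  have h3 : Set.range (fun x : (S : Set ι) ↦ b x) = b '' S := by ext; simp
  rw [h3] at h1
  simp only [SetLike.coe_sort_coe, Fintype.card_coe] at h1
  omega

/-- The points of the projective line determined by an arc of strength two are distinct. -/
lemma exists_injective_projectivization (h : IsLinearArc F b A 2) (hA : 2 ≤ A.card) :
    ∃ f : A → Projectivization F V, Function.Injective f ∧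
      ∀ i : A, ∃ hi : b i ≠ 0, f i = Projectivization.mk F (b i) hi := by
  refine ⟨fun i ↦ Projectivization.mk F (b i) (h.ne_zero hA (by simp) i.2), ?_,
    fun i ↦ ⟨_, rfl⟩⟩
  intro i j hij
  obtain ⟨c, hc⟩ := (Projectivization.mk_eq_mk_iff' F _ _ _ _).1 hij
  exact Subtype.ext (h.eq_of_eq_smul hA le_rfl i.2 j.2 hc.symm)

variable [Fintype F]

lemma card_le_of_finrank_two (h : IsLinearArc F b A 2) (hV : finrank F V = 2) :
    A.card ≤ Fintype.card F + 1 := by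
  have : FiniteDimensional F V := FiniteDimensional.of_finrank_pos (by omega)
  have : Finite V := Module.finite_of_finite F
  by_cases hA : 2 ≤ A.card
  · obtain ⟨f, hf, -⟩ := h.exists_injective_projectivization hA
    have := Nat.card_le_card_of_injective f hf
    rw [Projectivization.card_of_finrank_two F V hV] at this
    simpa using this
  · have := Fintype.card_pos (α := F)
    omega

lemma exists_eq_smul_of_finrank_two (h : IsLinearArc F b A 2) (hV : finrank F V = 2)
    (hA : A.card = Fintype.card F + 1) {v : V} (hv : v ≠ 0) : ∃ j ∈ A, ∃ c : F, v = c • b j := by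
  have : FiniteDimensional F V := FiniteDimensional.of_finrank_pos (by omega)
  have : Finite V := Module.finite_of_finite F
  have := Fintype.card_pos (α := F)
  obtain ⟨f, hf, hfb⟩ := h.exists_injective_projectivization (by omega)
  have hbij := hf.bijective_of_nat_card_le
    (by rw [Projectivization.card_of_finrank_two F V hV]; simp [hA])
  obtain ⟨j, hj⟩ := hbij.2 (Projectivization.mk F v hv)
  obtain ⟨hj0, hfj⟩ := hfb j
  rw [hfj] at hj
  obtain ⟨c, hc⟩ := (Projectivization.mk_eq_mk_iff' F _ _ _ _).1 hj.symm
  exact ⟨j, j.2, c, hc.symm⟩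

/-- A plane arc with `|F| + 2` points (a hyperoval) exists only in even characteristic. -/
lemma even_card_of_finrank_three (h : IsLinearArc F b A 3) (hV : finrank F V = 3)
    (hA : A.card = Fintype.card F + 2) : Even (Fintype.card F) := by
  classical
  have : FiniteDimensional F V := FiniteDimensional.of_finrank_pos (by omega)
  have hF := Fintype.one_lt_card (α := F)
  have harc (i) (hi : i ∈ A) :
      IsLinearArc F ((Submodule.span F (b '' ({i} : Finset ι))).mkQ ∘ b) (A \ {i}) 2 :=
    mkQ (S := {i}) h (by simpa)
  have hdim (i) (hi : i ∈ A) : finrank F (V ⧸ Submodule.span F (b '' ({i} : Finset ι))) = 2 :=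
    finrank_quotient (S := {i}) h (by simp; omega) (by simpa) hV
  have hcard (i) (hi : i ∈ A) : (A \ {i}).card = Fintype.card F + 1 := by
    rw [card_sdiff_of_subset (by simpa)]; simp [hA]
  obtain ⟨a₀, ha₀, a₁, ha₁, ha⟩ := one_lt_card.1 (show 1 < A.card by omega)
  obtain ⟨Q, hQ⟩ : ∃ Q, Q = b a₀ + b a₁ := ⟨_, rfl⟩
  have hQ0 (i) (hi : i ∈ A) : (Submodule.span F (b '' ({i} : Finset ι))).mkQ Q ≠ 0 := by
    have hne {j} (hj : j ∈ A) (hji : j ≠ i) :=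
      (harc i hi).ne_zero (i := j) (by rw [hcard i hi]; omega) (by simp) (by simp [hj, hji])
    have hz : (Submodule.span F (b '' ({i} : Finset ι))).mkQ (b i) = 0 := by simp
    rw [hQ, map_add]
    by_cases h0 : a₀ = i
    · rw [h0, hz, zero_add]
      exact hne ha₁ (h0 ▸ ha.symm)
    by_cases h1 : a₁ = i
    · rw [h1, hz, add_zero]
      exact hne ha₀ h0
    intro hsum
    refine ha ((harc i hi).eq_of_eq_smul (c := -1) (by rw [hcard i hi]; omega) le_rfl
      (by simp [ha₀, h0]) (by simp [ha₁, h1]) ?_)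
    simpa using eq_neg_of_add_eq_zero_left hsum
  have hex (i) (hi : i ∈ A) : ∃ j ∈ A \ {i}, ∃ c d : F, Q = c • b i + d • b j := by
    obtain ⟨j, hj, d, hd⟩ := (harc i hi).exists_eq_smul_of_finrank_two (hdim i hi)
      (hcard i hi) (hQ0 i hi)
    rw [Function.comp_apply, ← map_smul, ← sub_eq_zero, ← map_sub, Submodule.mkQ_apply,
      Submodule.Quotient.mk_eq_zero, coe_singleton, Set.image_singleton,
      Submodule.mem_span_singleton] at hd
    obtain ⟨c, hc⟩ := hd
    exact ⟨j, hj, c, d, by rw [hc]; abel⟩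
  have huniq (i) (hi : i ∈ A) (j) (hj : j ∈ A \ {i}) (k) (hk : k ∈ A \ {i})
      (hQj : ∃ c d : F, Q = c • b i + d • b j) (hQk : ∃ c d : F, Q = c • b i + d • b k) :
      j = k := by
    obtain ⟨c, d, hd⟩ := hQj
    obtain ⟨c', d', hd'⟩ := hQk
    have hz : (Submodule.span F (b '' ({i} : Finset ι))).mkQ (b i) = 0 := by simp
    have hqj := congrArg (Submodule.span F (b '' ({i} : Finset ι))).mkQ hd
    have hqk := congrArg (Submodule.span F (b '' ({i} : Finset ι))).mkQ hd'
    rw [map_add, map_smul, map_smul, hz, smul_zero, zero_add] at hqj hqk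
    have hd0 : d ≠ 0 := by
      rintro rfl
      exact hQ0 i hi (by rw [hqj, zero_smul])
    refine (harc i hi).eq_of_eq_smul (c := d⁻¹ * d') (by rw [hcard i hi]; omega) le_rfl hj hk ?_
    rw [Function.comp_apply, Function.comp_apply, mul_smul, ← hqk, hqj, inv_smul_smul₀ hd0]
  choose g hgA hg using hex
  have hgA' (i) (hi : i ∈ A) : g i hi ∈ A := (mem_sdiff.1 (hgA i hi)).1
  have hgi (i) (hi : i ∈ A) : g i hi ≠ i := by simpa using (mem_sdiff.1 (hgA i hi)).2
  have hsum : ∑ _i ∈ A, (1 : ZMod 2) = 0 := by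
    refine sum_involution g (fun _ _ ↦ by decide) (fun i hi _ ↦ hgi i hi) hgA' fun i hi ↦ ?_
    refine huniq _ (hgA' i hi) _ (hgA _ _) _ (by simp [hi, (hgi i hi).symm]) (hg _ _) ?_
    obtain ⟨c, d, hd⟩ := hg i hi
    exact ⟨d, c, by rw [hd, add_comm]⟩
  rw [sum_const, nsmul_one, ZMod.natCast_eq_zero_iff_even, hA] at hsum
  simpa [Nat.even_add] using hsum

/-- The projection bound for arcs in a space of dimension at least two. -/
lemma card_le [FiniteDimensional F V] (h : IsLinearArc F b A m) (hV : finrank F V = m)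
    (hm : 2 ≤ m) : A.card ≤ Fintype.card F + m - 1 := by
  classical
  have := Fintype.card_pos (α := F)
  by_cases hA : m ≤ A.card
  · obtain ⟨S, hS, hSc⟩ := exists_subset_card_eq (s := A) (n := m - 2) (by omega)
    obtain rfl : m = 2 + S.card := by omega
    have := (h.mkQ hS).card_le_of_finrank_two (h.finrank_quotient hA hS hV)
    rw [card_sdiff_of_subset hS] at this
    omega
  · omega

/-- The projection bound for arcs in odd characteristic. -/
lemma card_le_of_odd [FiniteDimensional F V] (h : IsLinearArc F b A m) (hV : finrank F V = m)
    (hm : 3 ≤ m) (hF : Odd (Fintype.card F)) : A.card ≤ Fintype.card F + m - 2 := by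
  classical
  by_contra! hA
  have hF1 := Fintype.one_lt_card (α := F)
  obtain ⟨S, hS, hSc⟩ := exists_subset_card_eq (s := A) (n := m - 3) (by omega)
  obtain rfl : m = 3 + S.card := by omega
  obtain ⟨B, hB, hBc⟩ := exists_subset_card_eq (s := A \ S) (n := Fintype.card F + 2)
    (by rw [card_sdiff_of_subset hS]; omega)
  have := ((h.mkQ hS).mono hB).even_card_of_finrank_three
    (h.finrank_quotient (by omega) hS hV) hBc
  exact Nat.not_even_iff_odd.2 hF this

/-- An arc with two more points than the dimension yields, by duality, an arc of strength two
in the plane of its linear relations. -/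
lemma lt_card_of_card_eq_add_two [FiniteDimensional F V] [Fintype ι]
    (h : IsLinearArc F b univ m) (hV : finrank F V = m) (hι : Fintype.card ι = m + 2) :
    m < Fintype.card F := by
  classical
  let L := Fintype.linearCombination F b
  have hL : finrank F L.ker = 2 := by
    obtain ⟨T, -, hT⟩ := exists_subset_card_eq (s := (univ : Finset ι)) (n := m)
      (by rw [card_univ]; omega)
    have hspan : Submodule.span F (Set.range fun i : (T : Set ι) ↦ b i) = ⊤ :=
      LinearIndependent.span_eq_top_of_card_eq_finrank' (h T (subset_univ T) hT) (by simp [hT, hV])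
    have htop : L.range = ⊤ := by
      rw [Fintype.range_linearCombination, eq_top_iff, ← hspan]
      exact Submodule.span_mono (by rintro _ ⟨i, rfl⟩; exact ⟨i, rfl⟩)
    have hr := L.finrank_range_add_finrank_ker
    rw [htop, finrank_top, finrank_pi, hV, hι] at hr
    omega
  have hrel (i : ι) : ∃ c : L.ker, c ≠ 0 ∧ (c : ι → F) i = 0 := by
    have hinj : ¬ Function.Injective ((LinearMap.proj i : (ι → F) →ₗ[F] F) ∘ₗ L.ker.subtype) :=
      fun hinj ↦ by simpa [hL] using LinearMap.finrank_le_finrank_of_injective hinj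
    rw [← LinearMap.ker_eq_bot, ← ne_eq, Submodule.ne_bot_iff] at hinj
    obtain ⟨c, hc, hc0⟩ := hinj
    exact ⟨c, hc0, hc⟩
  choose w hw0 hw using hrel
  have hzero (c : L.ker) {i j : ι} (hij : i ≠ j) (hi : (c : ι → F) i = 0)
      (hj : (c : ι → F) j = 0) : c = 0 := by
    have hc : ∑ k, (c : ι → F) k • b k = 0 := c.2
    have hl := h (univ \ {i, j}) (subset_univ _)
      (by rw [card_sdiff_of_subset (subset_univ _), card_univ, hι, card_pair hij]; omega)
    rw [linearIndepOn_finset_iff] at hl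
    have hs : ∑ k ∈ univ \ {i, j}, (c : ι → F) k • b k = 0 := by
      rw [← hc]
      refine sum_subset (subset_univ _) fun k _ hk ↦ ?_
      obtain rfl | rfl : k = i ∨ k = j := by simpa [or_iff_not_imp_left] using hk
      · rw [hi, zero_smul]
      · rw [hj, zero_smul]
    ext k
    by_cases hki : k = i
    · simpa [hki] using hi
    by_cases hkj : k = j
    · simpa [hkj] using hj
    exact hl _ hs k (by simp [hki, hkj])
  have hw_arc : IsLinearArc F w univ 2 := by
    intro T _ hT
    obtain ⟨i, j, hij, rfl⟩ := card_eq_two.1 hT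
    rw [coe_pair, LinearIndepOn.pair_iff w hij]
    intro c d hcd
    have hcoord (k : ι) : c * (w i : ι → F) k + d * (w j : ι → F) k = 0 := by
      simpa using congrArg (fun x : L.ker ↦ (x : ι → F) k) hcd
    constructor
    · by_contra hc
      exact hw0 i (hzero _ hij (hw i) (by simpa [hw j, hc] using hcoord j))
    · by_contra hd
      exact hw0 j (hzero _ hij (by simpa [hw i, hd] using hcoord i) (hw j))
  have := hw_arc.card_le_of_finrank_two hL
  rw [card_univ, hι] at this
  omega

end IsLinearArc

/-- if `F` is a finite field with `s > 2` elements, `u₁ ≥ 3`, and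
`b₁, …, bₙ ∈ F^{u₁}` (with `n ≥ u₁`) are such that any `u₁` of them are linearly
independent, then `n ≤ u₁ + 1` if `s ≤ u₁`; `n ≤ s + u₁ - 2` if `s > u₁` and `s`
is odd; and `n ≤ s + u₁ - 1` in all other cases. -/
theorem stmt10 {F : Type*} [Field F] [Fintype F] (hs : 2 < Fintype.card F)
    (u₁ n : ℕ) (hu₁ : 3 ≤ u₁) (hn : u₁ ≤ n)
    (b : Fin n → Fin u₁ → F)
    (hindep : ∀ T : Finset (Fin n), T.card = u₁ →
      LinearIndependent F (fun t : T => b t.1)) :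
    (Fintype.card F ≤ u₁ → n ≤ u₁ + 1) ∧
    (u₁ < Fintype.card F → Odd (Fintype.card F) → n ≤ Fintype.card F + u₁ - 2) ∧
    (u₁ < Fintype.card F → ¬ Odd (Fintype.card F) → n ≤ Fintype.card F + u₁ - 1) := by
  have harc : IsLinearArc F b univ u₁ := fun T _ hT ↦ hindep T hT
  have hV : finrank F (Fin u₁ → F) = u₁ := by simp
  refine ⟨fun hq ↦ ?_, fun _ hodd ↦ ?_, fun _ _ ↦ ?_⟩
  · by_contra! hlt
    obtain ⟨A, -, hA⟩ := exists_subset_card_eq (s := (univ : Finset (Fin n))) (n := u₁ + 2)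
      (by simpa [Nat.succ_le_iff] using hlt)
    have hsub : IsLinearArc F (fun i : A ↦ b i) univ u₁ := by
      intro T _ hT
      have := harc (T.map (Function.Embedding.subtype _)) (subset_univ _) (by simpa using hT)
      rw [coe_map] at this
      exact this.comp_of_image (Function.Embedding.injective _).injOn
    have := hsub.lt_card_of_card_eq_add_two hV (by simpa using hA)
    omega
  · simpa using harc.card_le_of_odd hV hu₁ hodd
  · simpa using harc.card_le hV (by omega)
end

section
/- Let F = GF(2), let u_1 ≥ 2 and w ≥ 2, and for y ∈ F^w let ȳ ∈ F^w denote its componentwise complement (ȳ_j = y_j + 1). Let x_0 ∈ F^{u_1} have its first two entries equal to 1 and all other entries 0, and for y ∈ F^w let η(y) = (x_0, ȳ) ∈ F^{u_1 + w} and x(y) = (1, …, 1, y) ∈ F^{u_1 + w} (the first u_1 entries equal to 1). Then ⟨η(y), x(y)⟩ = 0 for every y, and for any three pairwise distinct y_p, y_q, y_l ∈ F^w, the three vectors η(y_p), η(y_q), η(y_l) are linearly independent over GF(2). -/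
/-- Three distinct vectors over `GF(2)` sharing an entry equal to `1` are linearly independent. -/
theorem linearIndependent_of_common_entry_one {ι : Type*} {a b c : ι → ZMod 2} (i : ι)
    (ha : a i = 1) (hb : b i = 1) (hc : c i = 1) (hab : a ≠ b) (hac : a ≠ c) (hbc : b ≠ c) :
    LinearIndependent (ZMod 2) ![a, b, c] := by
  rw [Fintype.linearIndependent_iff]
  intro g hg
  have coord : ∀ j, g 0 * a j + g 1 * b j + g 2 * c j = 0 := fun j => by
    simpa [Fin.sum_univ_three] using congrFun hg j
  have hi : g 0 + g 1 + g 2 = 0 := by simpa [ha, hb, hc] using coord i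
  obtain ⟨j, hj⟩ := Function.ne_iff.mp hab
  obtain ⟨k, hk⟩ := Function.ne_iff.mp hac
  obtain ⟨l, hl⟩ := Function.ne_iff.mp hbc
  have hp : ∀ r s t x y z : ZMod 2, r + s + t = 0 → r * x + s * y + t * z = 0 →
      x ≠ y → t = 0 → r = 0 ∧ s = 0 := by decide
  have zero_or : ∀ r s t : ZMod 2, r + s + t = 0 → t = 0 ∨ s = 0 ∨ r = 0 := by decide
  rw [Fin.forall_fin_succ, Fin.forall_fin_two]
  change g 0 = 0 ∧ g 1 = 0 ∧ g 2 = 0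
  rcases zero_or _ _ _ hi with h | h | h
  · have := hp _ _ _ _ _ _ hi (coord j) hj h
    exact ⟨this.1, this.2, h⟩
  · have := hp (g 0) (g 2) (g 1) _ _ (b k) (by rw [← hi]; ring)
      (by rw [← coord k]; ring) hk h
    exact ⟨this.1, h, this.2⟩
  · have := hp (g 1) (g 2) (g 0) _ _ (a l) (by rw [← hi]; ring)
      (by rw [← coord l]; ring) hl h
    exact ⟨h, this.1, this.2⟩

/-- over `GF(2)`, with `x₀ ∈ F^{u₁}` having its first two entries `1` and all
others `0`, and for `y ∈ F^w` setting `η(y) = (x₀, ȳ) ∈ F^{u₁+w}` (where `ȳ` is the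
componentwise complement `ȳⱼ = yⱼ + 1`) and `x(y) = (1, …, 1, y) ∈ F^{u₁+w}`, we have
`⟨η(y), x(y)⟩ = 0` for every `y`, and for any three pairwise distinct `y_p, y_q, y_l`
the vectors `η(y_p), η(y_q), η(y_l)` are linearly independent over `GF(2)`. -/
theorem stmt11 (u₁ w : ℕ) (hu₁ : 2 ≤ u₁) (hw : 2 ≤ w)
    (x₀ : Fin u₁ → ZMod 2)
    (hx₀0 : x₀ ⟨0, by omega⟩ = 1) (hx₀1 : x₀ ⟨1, by omega⟩ = 1)
    (hx₀rest : ∀ i : Fin u₁, 2 ≤ (i : ℕ) → x₀ i = 0) :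
    (∀ y : Fin w → ZMod 2,
      ∑ i, Fin.append x₀ (fun j => y j + 1) i *
        Fin.append (fun _ : Fin u₁ => (1 : ZMod 2)) y i = 0) ∧
    (∀ yp yq yl : Fin w → ZMod 2, yp ≠ yq → yp ≠ yl → yq ≠ yl →
      LinearIndependent (ZMod 2)
        ![Fin.append x₀ (fun j => yp j + 1),
          Fin.append x₀ (fun j => yq j + 1),
          Fin.append x₀ (fun j => yl j + 1)]) := by
  refine ⟨fun y => ?_, fun yp yq yl hpq hpl hql => ?_⟩
  · have hcompl : ∀ a : ZMod 2, (a + 1) * a = 0 := by decide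
    have hx₀ : ∑ i, x₀ i = 0 := by
      obtain ⟨n, rfl⟩ := Nat.exists_eq_add_of_le' hu₁
      rw [Fin.sum_univ_succ, Fin.sum_univ_succ,
        Finset.sum_eq_zero fun i _ => hx₀rest i.succ.succ (by simp), add_zero]
      calc x₀ 0 + x₀ (Fin.succ 0) = 1 + 1 := congrArg₂ (· + ·) hx₀0 hx₀1
        _ = 0 := by decide
    simp [Fin.sum_univ_add, hcompl, hx₀]
  · have append_ne {a b : Fin w → ZMod 2} (h : a ≠ b) :
        Fin.append x₀ (fun j => a j + 1) ≠ Fin.append x₀ (fun j => b j + 1) := fun e =>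
      h <| funext fun j => by simpa using congrFun e (Fin.natAdd u₁ j)
    exact linearIndependent_of_common_entry_one (Fin.castAdd w ⟨0, by omega⟩)
      (by rw [Fin.append_left, hx₀0]) (by rw [Fin.append_left, hx₀0])
      (by rw [Fin.append_left, hx₀0]) (append_ne hpq) (append_ne hpl) (append_ne hql)
end

section
/- Let F = GF(2) and let u, u_1 be integers with 2 ≤ u_1 < u − 1; set w = u − u_1. Enumerate F^w as y_1, …, y_{2^w}; for each i let x_i = (1, …, 1, y_i) ∈ F^u (first u_1 entries 1), let η_i = (x_0, ȳ_i) ∈ F^u where x_0 has first two entries 1 and all other entries 0 and ȳ_i is the componentwise complement of y_i, and choose a basis (g_{i,1}, …, g_{i,u−1}) of O(x_i) with g_{i,1} = η_i. Define d_i : F^u → {0, …, 2^{u−1}−1} by d_i(c) = Σ_{j=1}^{u−1} 2^{u−1−j} ⟨c, g_{i,j}⟩ (interpreting each ⟨c, g_{i,j}⟩ ∈ GF(2) as 0 or 1). Then: (a) each d_i attains every value in {0, …, 2^{u−1}−1} exactly twice as c ranges over F^u, so the array with columns d_1, …, d_{2^w} is an OA(2^u, 2^w, 2^{u−1}, 1);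 and (b) for any three distinct indices p, q, l, the triple (⌊d_p(c)/2^{u−2}⌋, ⌊d_q(c)/2^{u−2}⌋, ⌊d_l(c)/2^{u−2}⌋) attains every value in {0,1}^3 exactly 2^{u−3} times as c ranges over F^u; that is, the design achieves stratification on a 2×2×2 grid in any three dimensions. -/
/-- The `s^{u-1}`-level column obtained from a generator family
`g : Fin (u-1) → GF(2)^u` by the method of replacement:
`d(c) = Σ_j 2^{u-2-j} ⟨c, g_j⟩` (0-based `j`, with `u = u₁ + w`). -/
def dCol (u₁ w : ℕ) (g : Fin (u₁ + w - 1) → Fin (u₁ + w) → ZMod 2)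
    (c : Fin (u₁ + w) → ZMod 2) : ℕ :=
  ∑ j : Fin (u₁ + w - 1), 2 ^ (u₁ + w - 2 - (j : ℕ)) * (∑ t, c t * g j t).val

/-- The solution set of a system of `k` linear equations in `n` unknowns over `GF(2)` with
linearly independent coefficient vectors has `2 ^ (n - k)` elements. -/
theorem ncard_setOf_dotProduct_eq {n k : ℕ} (v : Fin k → Fin n → ZMod 2)
    (hv : LinearIndependent (ZMod 2) v) (b : Fin k → ZMod 2) :
    {c : Fin n → ZMod 2 | ∀ j, ∑ t, c t * v j t = b j}.ncard = 2 ^ (n - k) := by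
  set T := Matrix.mulVecLin (Matrix.of v) with hT
  have hTc : ∀ c j, T c j = ∑ t, c t * v j t := fun c j => by
    simp [hT, Matrix.mulVec, dotProduct, mul_comm]
  have hrank : Module.finrank (ZMod 2) (LinearMap.range T) = k := by
    have := LinearIndependent.rank_matrix (M := Matrix.of v) hv
    simpa [Matrix.rank] using this
  have hker : Module.finrank (ZMod 2) (LinearMap.ker T) = n - k := by
    have := LinearMap.finrank_range_add_finrank_ker T
    rw [hrank, Module.finrank_fin_fun] at this
    omega
  have hsurj : LinearMap.range T = ⊤ :=
    Submodule.eq_top_of_finrank_eq (by rw [hrank, Module.finrank_fin_fun])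
  obtain ⟨c₀, hc₀⟩ := LinearMap.range_eq_top.mp hsurj b
  have hset : {c : Fin n → ZMod 2 | ∀ j, ∑ t, c t * v j t = b j}
      = (fun x => c₀ + x) '' (LinearMap.ker T : Set (Fin n → ZMod 2)) := by
    ext c
    have hc : (∀ j, ∑ t, c t * v j t = b j) ↔ T c = b := by
      simp only [funext_iff, hTc]
    simp only [Set.mem_ofPred_eq, hc, Set.mem_image, SetLike.mem_coe, LinearMap.mem_ker]
    constructor
    · intro h
      exact ⟨c - c₀, by rw [map_sub, h, hc₀, sub_self], by abel⟩
    · rintro ⟨x, hx, rfl⟩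
      rw [map_add, hx, hc₀, add_zero]
  rw [hset, Set.ncard_image_of_injective _ (add_right_injective c₀)]
  change Nat.card (LinearMap.ker T) = _
  rw [Module.natCard_eq_pow_finrank (K := ZMod 2), hker, Nat.card_zmod]

/-- The natural number with binary digits `b 0, …, b (m - 1)`, most significant first. -/
def binaryValue (m : ℕ) (b : Fin m → ZMod 2) : ℕ :=
  ∑ j : Fin m, 2 ^ (m - 1 - (j : ℕ)) * (b j).val

theorem binaryValue_succ (m : ℕ) (b : Fin (m + 1) → ZMod 2) :
    binaryValue (m + 1) b = 2 ^ m * (b 0).val + binaryValue m (fun j => b j.succ) := by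
  simp only [binaryValue, Fin.sum_univ_succ, Fin.val_zero, Fin.val_succ, Nat.add_sub_cancel,
    Nat.sub_zero]
  congr 1
  refine Finset.sum_congr rfl fun j _ => ?_
  rw [Nat.sub_sub, Nat.add_comm 1]

theorem binaryValue_lt (m : ℕ) (b : Fin m → ZMod 2) : binaryValue m b < 2 ^ m := by
  induction m with
  | zero => simp [binaryValue]
  | succ m ih =>
    rw [binaryValue_succ, pow_succ]
    have h1 := ih (fun j => b j.succ)
    have h2 : (b 0).val ≤ 1 := Nat.le_of_lt_succ (ZMod.val_lt (b 0))
    have h3 := Nat.mul_le_mul_left (2 ^ m) h2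
    omega

theorem binaryValue_succ_div (m : ℕ) (b : Fin (m + 1) → ZMod 2) :
    binaryValue (m + 1) b / 2 ^ m = (b 0).val := by
  rw [binaryValue_succ, Nat.mul_add_div (by positivity), Nat.div_eq_of_lt (binaryValue_lt m _),
    add_zero]

theorem binaryValue_div {m : ℕ} (hm : 0 < m) (b : Fin m → ZMod 2) :
    binaryValue m b / 2 ^ (m - 1) = (b ⟨0, hm⟩).val := by
  obtain ⟨k, rfl⟩ := Nat.exists_eq_succ_of_ne_zero hm.ne'
  exact binaryValue_succ_div k b

theorem binaryValue_injective (m : ℕ) : Function.Injective (binaryValue m) := by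
  induction m with
  | zero => exact fun b b' _ => Subsingleton.elim b b'
  | succ m ih =>
    intro b b' h
    have h0 : (b 0).val = (b' 0).val := by
      rw [← binaryValue_succ_div, ← binaryValue_succ_div, h]
    rw [binaryValue_succ, binaryValue_succ, h0] at h
    have ht := ih (Nat.add_left_cancel h)
    funext j
    refine Fin.cases (ZMod.val_injective 2 h0) (fun i => congrFun ht i) j

theorem exists_binaryValue_eq {m x : ℕ} (hx : x < 2 ^ m) : ∃ b, binaryValue m b = x := by
  have hbij : Function.Bijective
      (fun b : Fin m → ZMod 2 => (⟨binaryValue m b, binaryValue_lt m b⟩ : Fin (2 ^ m))) := by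
    rw [Fintype.bijective_iff_injective_and_card]
    refine ⟨fun b b' h => binaryValue_injective m (Fin.mk.inj_iff.mp h), ?_⟩
    simp [ZMod.card]
  obtain ⟨b, hb⟩ := hbij.2 ⟨x, hx⟩
  exact ⟨b, Fin.mk.inj_iff.mp hb⟩

theorem dCol_eq_binaryValue (u₁ w : ℕ) (g : Fin (u₁ + w - 1) → Fin (u₁ + w) → ZMod 2)
    (c : Fin (u₁ + w) → ZMod 2) :
    dCol u₁ w g c = binaryValue (u₁ + w - 1) (fun j => ∑ t, c t * g j t) := by
  simp only [dCol, binaryValue, Nat.sub_sub]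

/-- Three distinct vectors over `GF(2)` sharing a coordinate equal to `1` are linearly
independent. -/
theorem linearIndependent_of_coord_eq_one {ι : Type*} (x y z : ι → ZMod 2) (i : ι)
    (hx : x i = 1) (hy : y i = 1) (hz : z i = 1) (hxy : x ≠ y) (hxz : x ≠ z) (hyz : y ≠ z) :
    LinearIndependent (ZMod 2) ![x, y, z] := by
  rw [Fintype.linearIndependent_iff]
  intro a ha
  have hcoord : ∀ t, a 0 * x t + a 1 * y t + a 2 * z t = 0 := fun t => by
    simpa [Fin.sum_univ_three] using congrFun ha t
  have hi := hcoord i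
  rw [hx, hy, hz, mul_one, mul_one, mul_one] at hi
  have key : ∀ α β γ : ZMod 2, α + β + γ = 0 → (α = 0 ∧ β = 0 ∧ γ = 0) ∨
      (α = 1 ∧ β = 1 ∧ γ = 0) ∨ (α = 1 ∧ β = 0 ∧ γ = 1) ∨ (α = 0 ∧ β = 1 ∧ γ = 1) := by
    decide
  have hadd : ∀ α β : ZMod 2, α + β = 0 → α = β := by decide
  rcases key _ _ _ hi with ⟨h0, h1, h2⟩ | ⟨h0, h1, h2⟩ | ⟨h0, h1, h2⟩ | ⟨h0, h1, h2⟩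
  · intro j
    fin_cases j
    exacts [h0, h1, h2]
  · exact absurd (funext fun t => hadd _ _ (by simpa [h0, h1, h2] using hcoord t)) hxy
  · exact absurd (funext fun t => hadd _ _ (by simpa [h0, h1, h2] using hcoord t)) hxz
  · exact absurd (funext fun t => hadd _ _ (by simpa [h0, h1, h2] using hcoord t)) hyz

/-- anti-mirror arrangement: let `2 ≤ u₁ < u - 1`, `w = u - u₁` (formalized
as `u = u₁ + w` with `2 ≤ w`), let `Y` enumerate `GF(2)^w`, and for each `i` let
`xᵢ = (1,…,1,Yᵢ)`, `ηᵢ = (x₀, Ȳᵢ)` with `x₀` having first two entries `1` and the rest `0`,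
and let `gᵢ` be a basis of `O(xᵢ)` whose first vector is `ηᵢ`. Then (a) each column
`dᵢ` attains every value in `{0, …, 2^{u-1}-1}` exactly twice (so `(d₁, …, d_{2^w})` is an
OA(2^u, 2^w, 2^{u-1}, 1)), and (b) for any three distinct columns, the triple of values
`⌊dᵢ(c)/2^{u-2}⌋` attains every value of `{0,1}³` exactly `2^{u-3}` times: stratification on
a 2×2×2 grid in any three dimensions. -/
theorem stmt12 (u₁ w : ℕ) (hu₁ : 2 ≤ u₁) (hw : 2 ≤ w)
    (Y : Fin (2 ^ w) → Fin w → ZMod 2) (hY : Function.Bijective Y)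
    (x₀ : Fin u₁ → ZMod 2)
    (hx₀0 : x₀ ⟨0, by omega⟩ = 1) (hx₀1 : x₀ ⟨1, by omega⟩ = 1)
    (hx₀rest : ∀ i : Fin u₁, 2 ≤ (i : ℕ) → x₀ i = 0)
    (g : Fin (2 ^ w) → Fin (u₁ + w - 1) → Fin (u₁ + w) → ZMod 2)
    (hg_first : ∀ i, g i ⟨0, by omega⟩ = Fin.append x₀ (fun j => Y i j + 1))
    (hg_mem : ∀ i j, ∑ t, g i j t * Fin.append (fun _ : Fin u₁ => (1 : ZMod 2)) (Y i) t = 0)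
    (hg_indep : ∀ i, LinearIndependent (ZMod 2) (g i)) :
    (∀ (i : Fin (2 ^ w)) (lvl : ℕ), lvl < 2 ^ (u₁ + w - 1) →
      {c : Fin (u₁ + w) → ZMod 2 | dCol u₁ w (g i) c = lvl}.ncard = 2) ∧
    (∀ p q l : Fin (2 ^ w), p ≠ q → p ≠ l → q ≠ l →
      ∀ a b e : ℕ, a < 2 → b < 2 → e < 2 →
        {c : Fin (u₁ + w) → ZMod 2 |
            dCol u₁ w (g p) c / 2 ^ (u₁ + w - 2) = a ∧
            dCol u₁ w (g q) c / 2 ^ (u₁ + w - 2) = b ∧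
            dCol u₁ w (g l) c / 2 ^ (u₁ + w - 2) = e}.ncard = 2 ^ (u₁ + w - 3)) := by
  refine ⟨fun i lvl hlvl => ?_, fun p q l hpq hpl hql a b e ha hb he => ?_⟩
  · obtain ⟨b, rfl⟩ := exists_binaryValue_eq hlvl
    have h := ncard_setOf_dotProduct_eq (g i) (hg_indep i) b
    rw [show u₁ + w - (u₁ + w - 1) = 1 by omega, pow_one] at h
    refine Eq.trans (congrArg Set.ncard ?_) h
    ext c
    simp only [Set.mem_ofPred_eq, dCol_eq_binaryValue, (binaryValue_injective _).eq_iff,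
      funext_iff]
  · set η : Fin (2 ^ w) → Fin (u₁ + w) → ZMod 2 :=
      fun i => Fin.append x₀ (fun j => Y i j + 1) with hη
    have hη_inj : Function.Injective η := fun i i' h => hY.1 <| funext fun j => by
      simpa [hη] using congrFun h (Fin.natAdd u₁ j)
    have hη_one : ∀ i, η i (Fin.castAdd w ⟨0, by omega⟩) = 1 := fun i => by
      simp only [hη, Fin.append_left, hx₀0]
    have hind := linearIndependent_of_coord_eq_one (η p) (η q) (η l) _ (hη_one p) (hη_one q)
      (hη_one l) (hη_inj.ne hpq) (hη_inj.ne hpl) (hη_inj.ne hql)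
    rw [← ncard_setOf_dotProduct_eq _ hind ![(a : ZMod 2), b, e]]
    have hdiv : ∀ i c (x : ℕ), x < 2 →
        (dCol u₁ w (g i) c / 2 ^ (u₁ + w - 2) = x ↔ ∑ t, c t * η i t = x) := by
      intro i c x hx
      have h := binaryValue_div (m := u₁ + w - 1) (by omega) (fun j => ∑ t, c t * g i j t)
      rw [← dCol_eq_binaryValue, Nat.sub_sub, hg_first i] at h
      rw [h, ← (ZMod.val_injective 2).eq_iff, ZMod.val_natCast_of_lt hx]
    congr 1
    ext c
    simp only [Set.mem_ofPred_eq, hdiv _ _ _ ha, hdiv _ _ _ hb, hdiv _ _ _ he]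
    simp [Fin.forall_fin_succ]
end

section
/- Let F be a finite field with s elements, let u ≥ 2, and let x_1, …, x_k ∈ F^u be nonzero vectors that are pairwise non-proportional (x_i ≠ αx_j for i ≠ j and all α ∈ F). If k ≤ (s^{u−1} − 1)/(s − 1), then there exist nonzero vectors y_1, …, y_k with y_i ∈ O(x_i) for each i such that y_i and y_j are linearly independent for all i ≠ j; consequently, for every pair i ≠ j, the map c ↦ (⟨c, y_i⟩, ⟨c, y_j⟩) from F^u to F × F attains each value exactly s^{u−2} times, so the resulting design for the quantitative factors achieves stratification on an s × s grid in any two dimensions. -/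
open Module in
/-- Every fibre of a surjective linear map over a finite field has the size of the kernel. -/
theorem LinearMap.ncard_fiber_of_surjective {F V W : Type*} [Field F] [Fintype F]
    [AddCommGroup V] [Module F V] [FiniteDimensional F V] [AddCommGroup W] [Module F W]
    (f : V →ₗ[F] W) (hf : Function.Surjective f) (w : W) :
    {c | f c = w}.ncard = Fintype.card F ^ (finrank F V - finrank F W) := by
  obtain ⟨c₀, rfl⟩ := hf w
  have himage : {c | f c = f c₀} = (c₀ + ·) '' (LinearMap.ker f : Set V) := by
    ext c
    constructor
    · intro hc
      exact ⟨c - c₀, by simpa [sub_eq_zero] using hc, by simp⟩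
    · rintro ⟨d, hd, rfl⟩
      simpa using hd
  have hrank := f.finrank_range_add_finrank_ker
  rw [LinearMap.range_eq_top.mpr hf, finrank_top] at hrank
  rw [himage, Set.ncard_image_of_injective _ (add_right_injective c₀), ← Nat.card_coe_set_eq,
    ← hrank, Nat.add_sub_cancel_left, ← Nat.card_eq_fintype_card]
  exact Module.natCard_eq_pow_finrank (K := F) (V := LinearMap.ker f)

/-- Pairing against two linearly independent vectors attains each pair of values equally often. -/
theorem LinearIndependent.ncard_pairing_eq {F : Type*} [Field F] [Fintype F] {u : ℕ}
    {y z : Fin u → F} (h : LinearIndependent F ![y, z]) (a b : F) :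
    {c : Fin u → F | ∑ t, c t * y t = a ∧ ∑ t, c t * z t = b}.ncard
      = Fintype.card F ^ (u - 2) := by
  let M : Matrix (Fin 2) (Fin u) F := Matrix.of ![y, z]
  have hsurj : Function.Surjective M.mulVecLin := by
    rw [← LinearMap.range_eq_top]
    apply Submodule.eq_top_of_finrank_eq
    simpa [Matrix.rank] using LinearIndependent.rank_matrix (M := M) h
  have hfiber := M.mulVecLin.ncard_fiber_of_surjective hsurj ![a, b]
  simp only [Module.finrank_fin_fun] at hfiber
  rw [← hfiber]
  congr 1
  ext c
  simp [M, funext_iff, Fin.forall_fin_two, dotProduct, mul_comm]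

open scoped LinearAlgebra.Projectivization in
/-- The kernel of a nonzero linear form on `V` contains at least (in fact exactly)
`(s ^ (dim V - 1) - 1) / (s - 1)` projective points. -/
theorem Projectivization.le_card_filter_rep_eq_zero {F V : Type*} [Field F] [Fintype F]
    [AddCommGroup V] [Module F V] [FiniteDimensional F V] [Fintype (ℙ F V)]
    [DecidableEq F] (φ : V →ₗ[F] F) (hφ : φ ≠ 0) :
    (Fintype.card F ^ (Module.finrank F V - 1) - 1) / (Fintype.card F - 1)
      ≤ (Finset.univ.filter fun p : ℙ F V => φ p.rep = 0).card := by
  have hker : Nat.card (LinearMap.ker φ) = Fintype.card F ^ (Module.finrank F V - 1) := by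
    have := φ.ncard_fiber_of_surjective (LinearMap.surjective hφ) 0
    rw [Module.finrank_self] at this
    rw [← this]
    rfl
  have hcard := Projectivization.card'' F (LinearMap.ker φ)
  rw [hker, Nat.card_eq_fintype_card (α := F)] at hcard
  have hinj := Projectivization.map_injective (LinearMap.ker φ).subtype
    (LinearMap.ker φ).injective_subtype
  rw [← hcard, ← Set.ncard_univ, ← Set.ncard_image_of_injective _ hinj,
    ← Set.ncard_coe_finset]
  refine Set.ncard_le_ncard ?_ (Set.toFinite _)
  rintro _ ⟨p, -, rfl⟩
  induction p using Projectivization.ind with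
  | h v hv =>
    rw [Projectivization.map_mk]
    obtain ⟨a, ha⟩ := Projectivization.exists_smul_eq_mk_rep F (v : V) (by simpa using hv)
    simp only [Finset.coe_filter, Finset.mem_univ, true_and, Set.mem_ofPred_eq,
      Submodule.subtype_apply]
    rw [← ha, Units.smul_def, map_smul, LinearMap.mem_ker.mp v.2, smul_zero]


/-- if `x₁, …, x_k ∈ F^u` are nonzero, pairwise non-proportional, and
`k ≤ (s^{u-1} - 1)/(s - 1)`, then one can choose nonzero `yᵢ ∈ O(xᵢ)` such that `yᵢ`
and `yⱼ` are linearly independent for all `i ≠ j`; consequently for every `i ≠ j` the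
map `c ↦ (⟨c, yᵢ⟩, ⟨c, yⱼ⟩)` attains each value of `F × F` exactly `s^{u-2}` times
(stratification on an `s × s` grid in any two dimensions). -/
theorem stmt13 {F : Type*} [Field F] [Fintype F]
    (u k : ℕ) (hu : 2 ≤ u)
    (x : Fin k → Fin u → F) (hx : ∀ i, x i ≠ 0)
    (hprop : ∀ i j : Fin k, i ≠ j → ∀ α : F, x i ≠ α • x j)
    (hk : k ≤ (Fintype.card F ^ (u - 1) - 1) / (Fintype.card F - 1)) :
    ∃ y : Fin k → Fin u → F,
      (∀ i, y i ≠ 0) ∧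
      (∀ i, ∑ t, y i t * x i t = 0) ∧
      (∀ i j : Fin k, i ≠ j → LinearIndependent F ![y i, y j]) ∧
      (∀ i j : Fin k, i ≠ j → ∀ a b : F,
        {c : Fin u → F | ∑ t, c t * y i t = a ∧ ∑ t, c t * y j t = b}.ncard
          = Fintype.card F ^ (u - 2)) := by
  classical
  let φ (i : Fin k) : (Fin u → F) →ₗ[F] F := dotProductBilin F F (x i)
  have hφ (i : Fin k) : φ i ≠ 0 := fun h =>
    hx i (dotProduct_eq_zero _ fun w => LinearMap.congr_fun h w)
  have : Fintype (Projectivization F (Fin u → F)) := Fintype.ofFinite _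
  obtain ⟨f, hf, hfx⟩ :=
    (Fintype.all_card_le_filter_rel_iff_exists_injective
      fun (i : Fin k) (p : Projectivization F (Fin u → F)) => φ i p.rep = 0).mp <| by
    intro A
    obtain rfl | ⟨i, hi⟩ := A.eq_empty_or_nonempty
    · simp
    · have hle := Projectivization.le_card_filter_rep_eq_zero (φ i) (hφ i)
      rw [Module.finrank_fin_fun] at hle
      calc A.card ≤ k := by simpa using A.card_le_univ
        _ ≤ _ := hk.trans hle
        _ ≤ _ := Finset.card_le_card fun p hp => by
          simp only [Finset.mem_filter, Finset.mem_univ, true_and] at hp ⊢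
          exact ⟨i, hi, hp⟩
  have hind (i j : Fin k) (hij : i ≠ j) : LinearIndependent F ![(f i).rep, (f j).rep] := by
    have h := Projectivization.independent_iff.mp
      ((Projectivization.independent_pair_iff_ne _ _).mpr (hf.ne hij))
    rwa [← FinVec.map_eq] at h
  refine ⟨fun i => (f i).rep, fun i => (f i).rep_nonzero, fun i => ?_, hind,
    fun i j hij => (hind i j hij).ncard_pairing_eq⟩
  simpa [φ, dotProduct, mul_comm] using hfx i
end

section
/- Let F be a finite field with s elements, s > 2, and 1 ≤ u_1 ≤ u. Then the intersection ∩_{i=1}^{n_B} Ē_i, taken over all n_B = (s−1)^{u_1−1} vectors b_i, equals { α e_j : α ∈ F \ {0}, j = 1, …, u_1 }. -/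
/-- In a field with more than two elements, a vector with two nonzero coordinates is annihilated by
a functional that is nonzero on a prescribed set `P` containing these coordinates and zero
outside. -/
lemma exists_ne_zero_sum_mul_eq_zero {F ι : Type*} [Field F] [Fintype F] [Fintype ι]
    (hs : 2 < Fintype.card F) (P : ι → Prop) (z : ι → F) {j k : ι} (hjk : j ≠ k)
    (hPj : P j) (hPk : P k) (hj : z j ≠ 0) (hk : z k ≠ 0) :
    ∃ b : ι → F, (∀ i, P i → b i ≠ 0) ∧ (∀ i, ¬ P i → b i = 0) ∧ ∑ i, z i * b i = 0 := by
  classical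
  set g : ι → F := fun i => if P i then 1 else 0 with hg
  set c : F := z j + z k - ∑ i, z i * g i with hc
  obtain ⟨x, hx⟩ : ∃ x : F, x ∉ ({0, c} : Finset F) := by
    by_contra! h
    have h1 : Fintype.card F ≤ ({0, c} : Finset F).card :=
      Finset.card_le_card fun a _ => h a
    have h2 : ({0, c} : Finset F).card ≤ 2 := Finset.card_le_two
    omega
  simp only [Finset.mem_insert, Finset.mem_singleton, not_or] at hx
  have hxc : c - x ≠ 0 := sub_ne_zero.mpr (Ne.symm hx.2)
  refine ⟨g + Pi.single j (x / z j - 1) + Pi.single k ((c - x) / z k - 1), ?_, ?_, ?_⟩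
  · intro i hi
    by_cases hij : i = j
    · subst hij
      simp [hg, hi, hjk, hx.1, hj]
    · by_cases hik : i = k
      · subst hik
        simp [hg, hi, hij, hxc, hk]
      · simp [hg, hi, hij, hik]
  · intro i hi
    have hij : i ≠ j := by rintro rfl; exact hi hPj
    have hik : i ≠ k := by rintro rfl; exact hi hPk
    simp [hg, hi, hij, hik]
  · simp only [Pi.add_apply, mul_add, Finset.sum_add_distrib, Pi.single_apply, mul_ite, mul_zero,
      Finset.sum_ite_eq', Finset.mem_univ, if_true]
    rw [mul_sub, mul_sub, mul_div_cancel₀ _ hj, mul_div_cancel₀ _ hk]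
    linear_combination hc

/-- for a finite field `F` with `s > 2` elements and `1 ≤ u₁ ≤ u`, the
intersection `∩_{i=1}^{n_B} Ēᵢ`, taken over all `b`-vectors (vectors with first entry `1`,
nonzero entries in (1-based) positions `2, …, u₁`, and zero entries beyond `u₁`), equals
`{α eⱼ : α ∈ F \ {0}, j = 1, …, u₁}`. -/
theorem stmt15 {F : Type*} [Field F] [Fintype F] (hs : 2 < Fintype.card F)
    (u u₁ : ℕ) (hu₁ : 1 ≤ u₁) (hu : u₁ ≤ u) :
    {z : Fin u → F | (∀ i : Fin u, u₁ ≤ (i : ℕ) → z i = 0) ∧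
        ∀ b : Fin u → F,
          (b ⟨0, by omega⟩ = 1 ∧ (∀ i : Fin u, 1 ≤ (i : ℕ) → (i : ℕ) < u₁ → b i ≠ 0) ∧
            (∀ i : Fin u, u₁ ≤ (i : ℕ) → b i = 0)) →
          ∑ i, z i * b i ≠ 0}
      = {z : Fin u → F | ∃ α : F, α ≠ 0 ∧ ∃ j : Fin u, (j : ℕ) < u₁ ∧
          z = α • (Pi.single j 1 : Fin u → F)} := by
  ext z
  simp only [Set.mem_ofPred_eq]
  constructor
  · rintro ⟨hE, hz⟩
    obtain ⟨j, hj⟩ : ∃ j, z j ≠ 0 := by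
      by_contra! h
      refine hz (fun i => if (i : ℕ) < u₁ then 1 else 0) ⟨?_, ?_, ?_⟩ (by simp [h])
      · exact if_pos hu₁
      · intro i _ hi
        simp [hi]
      · intro i hi
        simp [hi]
    have hlt : ∀ i, z i ≠ 0 → (i : ℕ) < u₁ := fun i hi => by
      by_contra! h
      exact hi (hE i h)
    refine ⟨z j, hj, j, hlt j hj, ?_⟩
    ext k
    by_cases hkj : k = j
    · subst hkj
      simp
    · by_contra hk
      have hk : z k ≠ 0 := by simpa [hkj] using hk
      obtain ⟨b, hb, hb0, hsum⟩ := exists_ne_zero_sum_mul_eq_zero hs (fun i : Fin u => (i : ℕ) < u₁) z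
        hkj (hlt k hk) (hlt j hj) hk hj
      have h0 : b ⟨0, by omega⟩ ≠ 0 := hb _ hu₁
      refine hz (fun i => b i / b ⟨0, by omega⟩) ⟨div_self h0, ?_, ?_⟩ ?_
      · intro i _ hi
        exact div_ne_zero (hb i hi) h0
      · intro i hi
        simp [hb0 i (not_lt.mpr hi)]
      · simp only [← mul_div_assoc]
        rw [← Finset.sum_div, hsum, zero_div]
  · rintro ⟨α, hα, j, hj, rfl⟩
    refine ⟨?_, ?_⟩
    · intro i hi
      have hij : i ≠ j := by rintro rfl; omega
      simp [hij]
    · rintro b ⟨hb1, hb, -⟩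
      have hbj : b j ≠ 0 := by
        by_cases h : 1 ≤ (j : ℕ)
        · exact hb j h hj
        · have : j = ⟨0, by omega⟩ := Fin.ext (by simp; omega)
          rw [this, hb1]
          exact one_ne_zero
      simp [Pi.single_apply, hα, hbj]
end
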